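/- Let O be a W-orbit in ℝ^r and t ∈ T_O. For j ∈ {0,…,r} and μ ∈ ℤ^r define s_j(x^μ) := x^{s_jμ} for 1 ≤ j ≤ r and s_0(x^μ) := q^{μ_1}·x^{(−μ_1,μ_2,…,μ_r)}, set x^{α_0^∨} := q^{1/2}x_1^{−1}, x^{α_i^∨} := x_i x_{i+1}^{−1} (1 ≤ i < r), x^{α_r^∨} := x_r, and let (k_j, u_j) := (k_0, u_0) for j = 0, (k, k) for 1 ≤ j < r, and (k_r, u_r) for j = r. Then for each j and μ there is a unique R_{j,μ} ∈ span_F{x^λ : λ ∈ ℤ^r} with (1 − (x^{α_j^∨})^2)·R_{j,μ} = (k_j − k_j^{−1} + (u_j − u_j^{−1})·x^{α_j^∨})·(x^μ − s_j(x^μ)), and the operator identity T_j^O ∘ m_{x^μ} − m_{s_j(x^μ)} ∘ T_j^O = m_{R_{j,μ}} holds on F[O], where m_p denotes the operator of multiplication by p. (Together with the braid and Hecke relations of T_0^O,…,T_r^O, these identities express that F[O] carries a representation of Sahi's five-parameter double affine Hecke algebra of type C^∨C_r.) -/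

import Mathlib

open scoped Classical

noncomputable section

namespace QP

/-! ### The space of quasi-polynomials -/

/-- Euclidean space `ℝ^r`. -/
abbrev E (r : ℕ) := Fin r → ℝ

variable (F : Type*) [Field F] [CharZero F] (r : ℕ)

/-- The algebra of quasi-polynomials `F[ℝ^r]`: the group algebra of `(ℝ^r,+)` over `F`. -/
abbrev QA := AddMonoidAlgebra F (E r)

/-- The quasi-monomial `x^y`. -/
def X (y : E r) : QA F r := AddMonoidAlgebra.single y 1

/-- The `i`-th coordinate of a vector (`1`-based). -/
def cd (y : E r) (i : ℕ) : ℝ := ∑ m : Fin r, if (m : ℕ) + 1 = i then y m else 0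

/-- The standard basis vector `ε_i` (`1`-based). -/
def epsV (i : ℕ) : E r := fun m => if (m : ℕ) + 1 = i then 1 else 0

/-- The standard basis vector (`0`-based). -/
def eV (m : Fin r) : E r := fun n => if n = m then 1 else 0

/-- The Euclidean inner product on `ℝ^r`. -/
def ip (v y : E r) : ℝ := ∑ m : Fin r, v m * y m

/-- An integral vector regarded as an element of `ℝ^r`. -/
def zc (lam : Fin r → ℤ) : E r := fun m => (lam m : ℝ)

/-- The simple reflections of the hyperoctahedral group `W₀ = S_r ⋉ (±1)^r` (`1`-based):
for `1 ≤ i < r`, `sW i` interchanges the `i`-th and `(i+1)`-st coordinates, and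
`sW r` negates the last coordinate. -/
def sW (i : ℕ) (y : E r) : E r := fun m =>
  if i = r then (if (m : ℕ) + 1 = r then -y m else y m)
  else if (m : ℕ) + 1 = i then cd r y (i + 1)
  else if (m : ℕ) = i then cd r y i
  else y m

/-- `s_{ε₁} = s₁⋯s_{r-1} s_r s_{r-1}⋯s₁`: negation of the first coordinate. -/
def sEps1 (y : E r) : E r := fun m => if (m : ℕ) = 0 then -y m else y m

/-- The affine simple reflection `s₀ = τ(ε₁) s_{ε₁} : y ↦ (1 - y₁, y₂, …, y_r)`, together
with `genF j = sW j` for `1 ≤ j ≤ r`: the Coxeter generators of the affine Weyl group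
`W = W₀ ⋉ ℤ^r`. -/
def genF (j : ℕ) (y : E r) : E r :=
  if j = 0 then fun m => if (m : ℕ) = 0 then 1 - y m else y m
  else sW r j y

/-- The action of the word `s_{j₁} ⋯ s_{j_ℓ}` on `ℝ^r`. -/
def wordAct (l : List ℕ) (y : E r) : E r := l.foldr (genF r) y

/-- The closure of the fundamental alcove
`C₊ = {y : 0 < y_r < ⋯ < y₁ < 1/2}`. -/
def CplusCl : Set (E r) :=
  {y | (∀ i j : Fin r, i ≤ j → y j ≤ y i) ∧ ∀ m : Fin r, 0 ≤ y m ∧ y m ≤ 1 / 2}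

/-- The `W`-orbit of a point of `ℝ^r`. -/
def orbit (y : E r) : Set (E r) :=
  {z | ∃ l : List ℕ, (∀ a ∈ l, a ≤ r) ∧ wordAct r l y = z}

/-- `O` is a `W`-orbit in `ℝ^r`. -/
def IsOrbit (O : Set (E r)) : Prop := ∃ y, O = orbit r y

/-- `c^𝒪`: the unique point of the orbit `O` lying in the closed fundamental alcove. -/
def cpt (O : Set (E r)) : E r :=
  if h : ∃ c, c ∈ O ∧ c ∈ CplusCl r then h.choose else 0

/-- The length of an element of the affine Weyl group `W` (as a map on `ℝ^r`). -/
def wlen (g : E r → E r) : ℕ :=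
  sInf {n | ∃ l : List ℕ, (∀ a ∈ l, a ≤ r) ∧ l.length = n ∧ (fun y => wordAct r l y) = g}

/-- A choice of a shortest word `l` whose inverse maps `y` into the closed alcove;
the corresponding element of `W` is `g_y`. -/
def gW (y : E r) : List ℕ :=
  if h : ∃ l : List ℕ, (∀ a ∈ l, a ≤ r) ∧ wordAct r l.reverse y ∈ CplusCl r ∧
      ∀ l' : List ℕ, (∀ a ∈ l', a ≤ r) → wordAct r l'.reverse y ∈ CplusCl r →
        l.length ≤ l'.length
  then h.choose else []

/-- `g_y`, the unique shortest element of `W` with `g_y⁻¹ y` in the closed alcove. -/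
def gfun (y : E r) : E r → E r := fun z => wordAct r (gW r y) z

/-- The Bruhat order on `(W, {s₀,…,s_r})`, via the subword characterisation. -/
def bruhatLE (u v : E r → E r) : Prop :=
  ∃ l : List ℕ, (∀ a ∈ l, a ≤ r) ∧ (fun z => wordAct r l z) = v ∧ l.length = wlen r v ∧
    ∃ l' : List ℕ, l'.Sublist l ∧ (fun z => wordAct r l' z) = u ∧ l'.length = wlen r u

/-- The partial order on `ℝ^r`: `y' ≤ y` iff `y'` and `y` lie in the same `W`-orbit and
`g_{y'} ≤_B g_y` in the Bruhat order. -/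
def qle (y' y : E r) : Prop :=
  (∃ l : List ℕ, (∀ a ∈ l, a ≤ r) ∧ wordAct r l y = y') ∧ bruhatLE r (gfun r y') (gfun r y)

/-- Strict version of `qle`. -/
def qlt (y' y : E r) : Prop := qle r y' y ∧ y' ≠ y

/-- The `F`-linear operator on `F[ℝ^r]` determined by its values on the quasi-monomials. -/
def mkOp (Ψ : E r → QA F r) : Module.End F (QA F r) :=
  Finsupp.linearCombination F Ψ ∘ₗ (AddMonoidAlgebra.coeffLinearEquiv F).toLinearMap

/-- `F[O] = span_F {x^y : y ∈ O}`. -/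
def FO (O : Set (E r)) : Submodule F (QA F r) :=
  Submodule.span F {p | ∃ y ∈ O, p = X F r y}

/-- The Laurent polynomial subalgebra `F[ℤ^r] = span_F {x^μ : μ ∈ ℤ^r}`. -/
def Lspan : Submodule F (QA F r) :=
  Submodule.span F {p | ∃ lam : Fin r → ℤ, p = X F r (zc r lam)}

/-- `span_F {x^{y'} : y' < y}`. -/
def ltSpan (y : E r) : Submodule F (QA F r) :=
  Submodule.span F {p | ∃ y', qlt r y' y ∧ p = X F r y'}

/-! ### Floors and indicator/sign functions -/

/-- the largest even integer `≤ z` -/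
def floorE (z : ℝ) : ℤ := 2 * ⌊z / 2⌋
/-- the largest odd integer `≤ z` -/
def floorO (z : ℝ) : ℤ := 2 * ⌊(z + 1) / 2⌋ - 1
/-- indicator of `ℤ ⊆ ℝ` -/
def chiZ (z : ℝ) : ℕ := if ∃ n : ℤ, z = n then 1 else 0
/-- indicator of the even integers -/
def chiE (z : ℝ) : ℕ := if ∃ n : ℤ, z = 2 * n then 1 else 0
/-- indicator of the odd integers -/
def chiO (z : ℝ) : ℕ := if ∃ n : ℤ, z = 2 * n + 1 then 1 else 0
/-- `η_e`: `1` on even integers `≥ 2`, `-1` on even integers `≤ 0`, `0` otherwise -/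
def etaE (z : ℝ) : ℤ := if ∃ n : ℤ, z = 2 * n then (if 2 ≤ z then 1 else -1) else 0
/-- `η_o`: `1` on odd integers `≥ 1`, `-1` on odd integers `≤ -1`, `0` otherwise -/
def etaO (z : ℝ) : ℤ := if ∃ n : ℤ, z = 2 * n + 1 then (if 1 ≤ z then 1 else -1) else 0
/-- `η = η_e + η_o` -/
def eta (z : ℝ) : ℤ := etaE z + etaO z

/-- `geomS c v m` is the truncated geometric series `(1 - (c·x^v)^m)/(1 - c·x^v)`,
a genuine element of `F[ℝ^r]`; it is the unique element with
`(1 - c·x^v) * geomS c v m = 1 - c^m·x^{m v}`. -/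
def geomS (c : F) (v : E r) (m : ℤ) : QA F r :=
  if 0 ≤ m then ∑ t ∈ Finset.range m.toNat, c ^ (t : ℤ) • X F r ((t : ℝ) • v)
  else -∑ t ∈ Finset.range (-m).toNat, c ^ (-(t : ℤ) - 1) • X F r ((-(t : ℝ) - 1) • v)

/-! ### Truncated divided difference operators and Demazure–Lusztig operators -/

/-- `∇_i(x^y) = ((1 - (x_{i+1}/x_i)^{⌊y_i - y_{i+1}⌋})/(1 - x_i/x_{i+1}))·x^y`. -/
def nablaIel (i : ℕ) (y : E r) : QA F r :=
  geomS F r 1 (epsV r i - epsV r (i + 1)) (-⌊cd r y i - cd r y (i + 1)⌋) * X F r y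

/-- `∇_r^e(x^y) = ((1 - x_r^{-⌊2y_r⌋_e})/(1 - x_r^2))·x^y`. -/
def nablaReEl (y : E r) : QA F r :=
  geomS F r 1 ((2 : ℝ) • epsV r r) (-floorE (2 * cd r y r) / 2) * X F r y

/-- `∇_r^o(x^y) = ((x_r - x_r^{-⌊2y_r⌋_o})/(1 - x_r^2))·x^y`. -/
def nablaRoEl (y : E r) : QA F r :=
  X F r (epsV r r) *
    geomS F r 1 ((2 : ℝ) • epsV r r) ((-floorO (2 * cd r y r) - 1) / 2) * X F r y

def nablaIop (i : ℕ) : Module.End F (QA F r) := mkOp F r (nablaIel F r i)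
def nablaReOp : Module.End F (QA F r) := mkOp F r (nablaReEl F r)
def nablaRoOp : Module.End F (QA F r) := mkOp F r (nablaRoEl F r)

/-- The value of the truncated Demazure–Lusztig operator `T_i` (`1 ≤ i ≤ r`) on `x^y`. -/
def Tel (k kr ur : F) (i : ℕ) (y : E r) : QA F r :=
  if i = r then
    (kr ^ chiE (2 * cd r y r) * ur ^ chiO (2 * cd r y r)) • X F r (sW r r y)
      + (kr - kr⁻¹) • nablaReEl F r y + (ur - ur⁻¹) • nablaRoEl F r y
  else
    k ^ chiZ (cd r y i - cd r y (i + 1)) • X F r (sW r i y)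
      + (k - k⁻¹) • nablaIel F r i y

/-- The truncated Demazure–Lusztig operators `T_1, …, T_r` on `F[ℝ^r]`. -/
def Top (k kr ur : F) (i : ℕ) : Module.End F (QA F r) := mkOp F r (Tel F r k kr ur i)

/-! ### The torus and the affine generator -/

/-- `t^{ε_i}`: the `i`-th coordinate (`1`-based) of an element of the torus `T = (Fˣ)^r`. -/
def tcU (t : Fin r → Fˣ) (i : ℕ) : Fˣ := ∏ m : Fin r, if (m : ℕ) + 1 = i then t m else 1

/-- `t^λ` for `λ ∈ ℤ^r`. -/
def upow (t : Fin r → Fˣ) (lam : Fin r → ℤ) : Fˣ := ∏ m : Fin r, t m ^ lam m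

/-- `t^v` for a vector `v` with integral entries (entries read off via the floor). -/
def upowR (t : Fin r → Fˣ) (v : E r) : Fˣ := ∏ m : Fin r, t m ^ ⌊v m⌋

/-- The `W`-action on the torus `T = (Fˣ)^r`: for `g = τ(λ)w₀ ∈ W` (so `g y = w₀ y + λ`),
`(g t)_m = q^{λ_m} · t^{w₀⁻¹ ε_m}`, where `W₀` permutes and inverts coordinates and
`τ(λ) t = q^λ t`, with `q = (q^{1/2})²`. -/
def torusAct (qh : Fˣ) (g : E r → E r) (t : Fin r → Fˣ) : Fin r → Fˣ := fun m =>
  (qh * qh) ^ ⌊g 0 m⌋ * ∏ j : Fin r, t j ^ ⌊(g (eV r j) - g 0) m⌋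

/-- The action on the torus of the linear part of `g` alone (the `W₀`-action). -/
def torusAct0 (g : E r → E r) (t : Fin r → Fˣ) : Fin r → Fˣ := fun m =>
  ∏ j : Fin r, t j ^ ⌊(g (eV r j) - g 0) m⌋

/-- The simple affine roots `α₀(y) = 1 - 2y₁`, `α_i(y) = y_i - y_{i+1}` (`1 ≤ i < r`),
`α_r(y) = 2 y_r` as affine-linear functionals. -/
def alphaF (j : ℕ) (y : E r) : ℝ :=
  if j = 0 then 1 - 2 * cd r y 1
  else if j = r then 2 * cd r y r
  else cd r y j - cd r y (j + 1)

/-- `t^{α_j^∨}` where `α₀^∨ = (-ε₁, 1/2)`, `α_i^∨ = (ε_i - ε_{i+1}, 0)`, `α_r^∨ = (ε_r, 0)`. -/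
def tpowCo (qh : Fˣ) (t : Fin r → Fˣ) (j : ℕ) : Fˣ :=
  if j = 0 then qh * (tcU F r t 1)⁻¹
  else if j = r then tcU F r t r
  else tcU F r t j * (tcU F r t (j + 1))⁻¹

/-- The affine subtorus `T_𝒪 = {t ∈ T : t^{α_j^∨} = 1 whenever α_j(c^𝒪) = 0}`. -/
def TOset (qh : Fˣ) (O : Set (E r)) : Set (Fin r → Fˣ) :=
  {t | ∀ j : ℕ, j ≤ r → alphaF r j (cpt r O) = 0 → tpowCo F r qh t j = 1}

/-- `∇₀^e(x^y) = ((1 - (q^{-1/2}x₁)^{⌊-2y₁⌋_e})/(1 - q x₁^{-2}))·x^y`. -/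
def nabla0eEl (qh : F) (y : E r) : QA F r :=
  geomS F r (qh * qh) ((-2 : ℝ) • epsV r 1) (-floorE (-2 * cd r y 1) / 2) * X F r y

/-- `∇₀^o(x^y) = ((q^{1/2}x₁^{-1} - (q^{-1/2}x₁)^{⌊-2y₁⌋_o})/(1 - q x₁^{-2}))·x^y`. -/
def nabla0oEl (qh : F) (y : E r) : QA F r :=
  (qh • X F r ((-1 : ℝ) • epsV r 1)) *
    geomS F r (qh * qh) ((-2 : ℝ) • epsV r 1) ((-floorO (-2 * cd r y 1) - 1) / 2) * X F r y

/-- The value of `T₀^𝒪` on `x^y`. -/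
def T0el (qh : Fˣ) (k0 u0 : F) (t : Fin r → Fˣ) (y : E r) : QA F r :=
  (k0 ^ chiE (2 * cd r y 1) * u0 ^ chiO (2 * cd r y 1) *
      ((tcU F r (torusAct F r qh (gfun r y) t) 1 : Fˣ) : F)) • X F r (sEps1 r y)
    + (k0 - k0⁻¹) • nabla0eEl F r qh y + (u0 - u0⁻¹) • nabla0oEl F r qh y

/-- The operator `T₀^𝒪` (as a globally defined operator; on `F[𝒪]` it is the operator of
the quasi-polynomial representation). -/
def T0op (qh : Fˣ) (k0 u0 : F) (t : Fin r → Fˣ) : Module.End F (QA F r) :=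
  mkOp F r (T0el F r qh k0 u0 t)

/-- The full family `T₀^𝒪, T₁, …, T_r`. -/
def Tfull (qh : Fˣ) (k0 u0 k kr ur : F) (t : Fin r → Fˣ) (j : ℕ) : Module.End F (QA F r) :=
  if j = 0 then T0op F r qh k0 u0 t else Top F r k kr ur j

/-- The Hecke parameter `k_j` (`k₀`, `k` or `k_r`). -/
def kpar (k0 k kr : F) (j : ℕ) : F := if j = 0 then k0 else if j = r then kr else k

/-- `(T_j^𝒪)⁻¹ = T_j^𝒪 - k_j + k_j⁻¹` (the inverse on `F[𝒪]`, by the Hecke relation). -/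
def TfullInv (qh : Fˣ) (k0 u0 k kr ur : F) (t : Fin r → Fˣ) (j : ℕ) : Module.End F (QA F r) :=
  Tfull F r qh k0 u0 k kr ur t j - (kpar F r k0 k kr j - (kpar F r k0 k kr j)⁻¹) • 1

/-- The word `0, 1, …, r-1, r, r-1, …, i` used in the definition of `Y_i^𝒪`. -/
def Ylist (i : ℕ) : List ℕ :=
  0 :: (((List.range (r - 1)).map (· + 1)) ++ [r] ++ ((List.range (r - i)).map fun m => r - 1 - m))

/-- The commuting operators
`Y_i^𝒪 = (T_{i-1}^𝒪)⁻¹⋯(T₁^𝒪)⁻¹ · T₀^𝒪 · T₁^𝒪⋯T_{r-1}^𝒪 · T_r^𝒪 · T_{r-1}^𝒪⋯T_i^𝒪`. -/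
def Yop (qh : Fˣ) (k0 u0 k kr ur : F) (t : Fin r → Fˣ) (i : ℕ) : Module.End F (QA F r) :=
  ((((List.range (i - 1)).map (· + 1)).reverse.map (TfullInv F r qh k0 u0 k kr ur t)).prod) *
    (((Ylist r i).map (Tfull F r qh k0 u0 k kr ur t)).prod)

/-! ### The base points `𝔰^𝒪`, `𝔰_y` and the spectrum -/

/-- `n_i^𝒪` (with `c = c^𝒪`), resp. `m_i(y)` (with `c = y`). -/
def nO (c : E r) (m : Fin r) : ℤ :=
  (∑ j : Fin r, if m < j then eta (c m - c j) + eta (c m + c j) else 0) +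
    ∑ j : Fin r, if j < m then eta (c j + c m) - eta (c j - c m) else 0

/-- The base point `𝔰^𝒪 ∈ T`. -/
def sOtor (k0 u0 k kr ur : Fˣ) (O : Set (E r)) : Fin r → Fˣ := fun m =>
  (k0 * kr) ^ (-(chiE (2 * cpt r O m) : ℤ)) * (u0 * ur) ^ (chiO (2 * cpt r O m) : ℤ) *
    k ^ nO r (cpt r O) m

/-- The eigenvalue `γ_i^𝒪(y) = ((g_y(𝔰^𝒪·t))_i)⁻¹`. -/
def gammaO (qh k0 u0 k kr ur : Fˣ) (O : Set (E r)) (t : Fin r → Fˣ) (i : ℕ) (y : E r) : Fˣ :=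
  (tcU F r (torusAct F r qh (gfun r y) fun m => sOtor F r k0 u0 k kr ur O m * t m) i)⁻¹

/-- `𝔰_y ∈ T`. -/
def sfrak (k0 u0 k kr ur : Fˣ) (y : E r) : Fin r → Fˣ := fun m =>
  (k0 * kr) ^ etaE (2 * y m) * (u0 * ur) ^ etaO (2 * y m) * k ^ nO r y m

/-! ### Finite Weyl group combinatorics, positive roots -/

/-- The set of positive roots of type `C_r`. -/
def PhiPlus : Set (E r) :=
  {v | (∃ a b : Fin r, a < b ∧ v = eV r a - eV r b) ∨
       (∃ a b : Fin r, a < b ∧ v = eV r a + eV r b) ∨ ∃ a : Fin r, v = (2 : ℝ) • eV r a}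

/-- The root system of type `C_r`. -/
def Phi0 : Set (E r) := PhiPlus r ∪ {v | -v ∈ PhiPlus r}

/-- The normalisation factor `κ_w^𝒪 = ∏_{α ∈ Π(w)} 𝐤_α^{χ_e(α(c))}·𝐤_{α/2}^{-χ_o(α(c))}`,
where `Π(w) = {α ∈ Φ₀⁺ : wα ∈ -Φ₀⁺}`, `𝐤_α = 𝐤_{α/2} = k` for short roots and
`𝐤_α = k_r`, `𝐤_{α/2} = u_r` for long roots. -/
def kappaW (k kr ur : Fˣ) (w : E r → E r) (c : E r) : Fˣ :=
  (∏ p : Fin r × Fin r,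
      if p.1 < p.2 ∧ -w (eV r p.1 - eV r p.2) ∈ PhiPlus r then
        k ^ ((chiE (ip r (eV r p.1 - eV r p.2) c) : ℤ) - (chiO (ip r (eV r p.1 - eV r p.2) c) : ℤ))
      else 1) *
  (∏ p : Fin r × Fin r,
      if p.1 < p.2 ∧ -w (eV r p.1 + eV r p.2) ∈ PhiPlus r then
        k ^ ((chiE (ip r (eV r p.1 + eV r p.2) c) : ℤ) - (chiO (ip r (eV r p.1 + eV r p.2) c) : ℤ))
      else 1) *
  ∏ a : Fin r,
      if -w ((2 : ℝ) • eV r a) ∈ PhiPlus r then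
        kr ^ (chiE (ip r ((2 : ℝ) • eV r a) c) : ℤ) * ur ^ (-(chiO (ip r ((2 : ℝ) • eV r a) c) : ℤ))
      else 1

/-- Iterated application `T_{i₁}(T_{i₂}(⋯(T_{i_ℓ}(f))⋯))`. -/
def applyT (k kr ur : F) (l : List ℕ) (f : QA F r) : QA F r :=
  l.foldr (fun i g => Top F r k kr ur i g) f

/-- The length function of the finite Weyl group `W₀`. -/
def w0len (g : E r → E r) : ℕ :=
  sInf {n | ∃ l : List ℕ, (∀ a ∈ l, 1 ≤ a ∧ a ≤ r) ∧ l.length = n ∧ (fun y => wordAct r l y) = g}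

/-- Membership in `W₀` (as maps on `ℝ^r`). -/
def IsW0fun (w : E r → E r) : Prop :=
  ∃ l : List ℕ, (∀ a ∈ l, 1 ≤ a ∧ a ≤ r) ∧ w = fun y => wordAct r l y

/-- Membership in the parabolic subgroup `W_{0,𝒪}` generated by the `s_i`, `1 ≤ i ≤ r`,
with `α_i(c^𝒪) = 0`. -/
def IsWOOfun (O : Set (E r)) (u : E r → E r) : Prop :=
  ∃ l : List ℕ, (∀ a ∈ l, 1 ≤ a ∧ a ≤ r ∧ alphaF r a (cpt r O) = 0) ∧
    u = fun y => wordAct r l y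

/-- `v ∈ W₀^𝒪`: `v ∈ W₀` of minimal length in its coset `v·W_{0,𝒪}`. -/
def MinRep (O : Set (E r)) (v : E r → E r) : Prop :=
  IsW0fun r v ∧ ∀ u, IsWOOfun r O u → w0len r v ≤ w0len r fun y => v (u y)

/-- Membership in the affine Weyl group `W` (as maps on `ℝ^r`). -/
def IsWfun (g : E r → E r) : Prop :=
  ∃ l : List ℕ, (∀ a ∈ l, a ≤ r) ∧ g = fun y => wordAct r l y

/-- Membership in the parabolic subgroup `W_{J(𝒪)}` generated by the `s_j`, `j ∈ J(𝒪)`. -/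
def IsWJfun (O : Set (E r)) (u : E r → E r) : Prop :=
  ∃ l : List ℕ, (∀ a ∈ l, a ≤ r ∧ alphaF r a (cpt r O) = 0) ∧ u = fun y => wordAct r l y

/-- The `W`-action on the Laurent polynomials `F[ℤ^r]` by `q`-dilations and reflections:
`w(x^μ) = x^{wμ}` for `w ∈ W₀`, `τ(λ)(x^μ) = q^{-⟨μ,λ⟩} x^μ` (globally defined via the
linear/translation parts of `g`). -/
def LWact (qh : Fˣ) (g : E r → E r) : Module.End F (QA F r) :=
  mkOp F r fun v => (((qh * qh) ^ (-⌊ip r (g v - g 0) (g 0)⌋) : Fˣ) : F) • X F r (g v - g 0)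

/-! ### roots `ᾱ_j`, torus reflections -/

/-- The finite simple roots `ᾱ₀ = -2ε₁`, `ᾱ_i = ε_i - ε_{i+1}`, `ᾱ_r = 2ε_r`
(as integral vectors). -/
def abarI (j : ℕ) : Fin r → ℤ := fun m =>
  if j = 0 then (if (m : ℕ) = 0 then -2 else 0)
  else if j = r then (if (m : ℕ) + 1 = r then 2 else 0)
  else if (m : ℕ) + 1 = j then 1
  else if (m : ℕ) = j then -1
  else 0

/-- The corresponding coroots `ᾱ₀^∨ = -ε₁`, `ᾱ_i^∨ = ε_i - ε_{i+1}`, `ᾱ_r^∨ = ε_r`. -/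
def abarV (j : ℕ) : Fin r → ℤ := fun m =>
  if j = 0 then (if (m : ℕ) = 0 then -1 else 0)
  else if j = r then (if (m : ℕ) + 1 = r then 1 else 0)
  else if (m : ℕ) + 1 = j then 1
  else if (m : ℕ) = j then -1
  else 0

/-- `ᾱ_j` as a real vector. -/
def abarR (j : ℕ) : E r := fun m => ((abarI r j m : ℤ) : ℝ)

/-- The constants `c₀ = u₀u_r`, `c_i = k²`, `c_r = k₀k_r`. -/
def cpar (k0 u0 k kr ur : Fˣ) (j : ℕ) : Fˣ :=
  if j = 0 then u0 * ur else if j = r then k0 * kr else k * k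

/-- The action of the reflection `s_{ᾱ_j} ∈ W₀` on the torus `T` (with `s_{ᾱ₀} = s_{ε₁}`). -/
def sTor (j : ℕ) (t : Fin r → Fˣ) : Fin r → Fˣ := fun m =>
  if j = 0 then (if (m : ℕ) = 0 then (t m)⁻¹ else t m)
  else if j = r then (if (m : ℕ) + 1 = r then (t m)⁻¹ else t m)
  else if (m : ℕ) + 1 = j then tcU F r t (j + 1)
  else if (m : ℕ) = j then tcU F r t j
  else t m

/-! ### The operators `G_t^𝒪(a)` for affine roots `a = (α, n)` -/

/-- The coroot `α^∨ = 2α/⟨α,α⟩`. -/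
def coroot (v : E r) : E r := ((2 : ℝ) / ip r v v) • v

/-- The scalar `q^{2n/⟨α,α⟩}` appearing in `x^{a^∨}` for `a = (α,n)`. -/
def qsc (qh : Fˣ) (v : E r) (n : ℤ) : Fˣ := if ip r v v = 4 then qh ^ n else (qh * qh) ^ n

/-- `𝐤_a`: `k` if `α` is short; `k_r` if `α` long, `n` even; `k₀` if `α` long, `n` odd. -/
def kaf (k0 k kr : Fˣ) (v : E r) (n : ℤ) : Fˣ :=
  if ip r v v = 4 then (if Even n then kr else k0) else k

/-- `𝐤_{a/2}`: `k` if `α` is short; `u_r` if `α` long, `n` even; `u₀` if `α` long, `n` odd. -/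
def khaf (u0 k ur : Fˣ) (v : E r) (n : ℤ) : Fˣ :=
  if ip r v v = 4 then (if Even n then ur else u0) else k

/-- The reflection `s_α(y) = y - α(y)·α^∨`. -/
def sRefl (v y : E r) : E r := y - ip r v y • coroot r v

/-- `s_{a,t}(x^y) = (g_y t)^{-n α^∨} · x^{s_α y}`. -/
def saTel (qh : Fˣ) (t : Fin r → Fˣ) (v : E r) (n : ℤ) (y : E r) : QA F r :=
  ((upowR F r (torusAct F r qh (gfun r y) t) (((-n : ℤ) : ℝ) • coroot r v) : Fˣ) : F) •
    X F r (sRefl r v y)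

/-- The twisted reflection operator `s_{a,t}`. -/
def SaOp (qh : Fˣ) (t : Fin r → Fˣ) (v : E r) (n : ℤ) : Module.End F (QA F r) :=
  mkOp F r (saTel F r qh t v n)

/-- The value `G_t^𝒪(a)(x^y)` for the affine root `a = (v, n)`. -/
def Gel (qh k0 u0 k kr ur : Fˣ) (t : Fin r → Fˣ) (v : E r) (n : ℤ) (y : E r) : QA F r :=
  (((kaf F r k0 k kr v n : Fˣ) : F) ^ chiE (ip r v y) *
      ((khaf F r u0 k ur v n : Fˣ) : F) ^ chiO (ip r v y)) • X F r y
    + ((((kaf F r k0 k kr v n : Fˣ) : F) - ((kaf F r k0 k kr v n : Fˣ) : F)⁻¹) •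
          geomS F r (((qsc F r qh v n)⁻¹ * (qsc F r qh v n)⁻¹ : Fˣ) : F)
            ((-2 : ℝ) • coroot r v) (-floorE (ip r v y) / 2)
        + (((khaf F r u0 k ur v n : Fˣ) : F) - ((khaf F r u0 k ur v n : Fˣ) : F)⁻¹) •
          ((((qsc F r qh v n)⁻¹ : Fˣ) : F) • X F r ((-1 : ℝ) • coroot r v) *
            geomS F r (((qsc F r qh v n)⁻¹ * (qsc F r qh v n)⁻¹ : Fˣ) : F)
              ((-2 : ℝ) • coroot r v) (-(floorO (ip r v y) + 1) / 2))) *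
      saTel F r qh t v n y

/-- The operator `G_t^𝒪(a)` for `a = (v, n)`. -/
def Gop (qh k0 u0 k kr ur : Fˣ) (t : Fin r → Fˣ) (v : E r) (n : ℤ) : Module.End F (QA F r) :=
  mkOp F r (Gel F r qh k0 u0 k kr ur t v n)

/-- The twisted action `g_t` of `g ∈ W` on `F[𝒪]`:
`g_t(x^y) = (g_{w₀ y} t)^{-λ} x^{w₀ y}` for `g = τ(λ) w₀`. -/
def Wtw (qh : Fˣ) (t : Fin r → Fˣ) (g : E r → E r) : Module.End F (QA F r) :=
  mkOp F r fun y =>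
    (((upowR F r (torusAct F r qh (gfun r (g y - g 0)) t) (g 0))⁻¹ : Fˣ) : F) •
      X F r (g y - g 0)

/-! ### The operators `D_j` -/

/-- The palindromic word `1, …, r-1, r, r-1, …, 1`. -/
def palin : List ℕ :=
  ((List.range (r - 1)).map (· + 1)) ++ [r] ++ ((List.range (r - 1)).map (· + 1)).reverse

/-- Multiplication by `x^{-ε₁}`. -/
def Mop : Module.End F (QA F r) := mkOp F r fun y => X F r ((-1 : ℝ) • epsV r 1) * X F r y

/-- `D₀ = (T₁^𝒪 ⋯ T_{r-1}^𝒪 T_r^𝒪 T_{r-1}^𝒪 ⋯ T₁^𝒪)⁻¹ ∘ M`. -/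
def D0op (qh : Fˣ) (k0 u0 k kr ur : F) (t : Fin r → Fˣ) : Module.End F (QA F r) :=
  ((palin r).map (TfullInv F r qh k0 u0 k kr ur t)).prod * Mop F r

/-- `D_j`: `D₀` for `j = 0` and `T_j^𝒪` for `1 ≤ j ≤ r`. -/
def Dop (qh : Fˣ) (k0 u0 k kr ur : F) (t : Fin r → Fˣ) (j : ℕ) : Module.End F (QA F r) :=
  if j = 0 then D0op F r qh k0 u0 k kr ur t else Tfull F r qh k0 u0 k kr ur t j

/-- Iterated application `D_{j₁}(D_{j₂}(⋯(D_{j_ℓ}(f))⋯))`. -/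
def applyD (qh : Fˣ) (k0 u0 k kr ur : F) (t : Fin r → Fˣ) (l : List ℕ) (f : QA F r) : QA F r :=
  l.foldr (fun j g => Dop F r qh k0 u0 k kr ur t j g) f

/-- The coefficients `k_{s_j}(y)`. -/
def ksj (k kr ur : Fˣ) (j : ℕ) (y : E r) : Fˣ :=
  if j = 0 then
    kr ^ (-etaE (2 * cd r y 1)) * ur ^ (-etaO (2 * cd r y 1)) *
      ∏ m : Fin r,
        (if 1 ≤ (m : ℕ) then k ^ (-eta (cd r y 1 - y m) - eta (cd r y 1 + y m)) else 1)
  else if j = r then kr ^ (-etaE (2 * cd r y r)) * ur ^ (-etaO (2 * cd r y r))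
  else k ^ (-eta (cd r y j - cd r y (j + 1)))

/-- `k_w(c) = ∏_m k_{s_{j_m}}(s_{j_{m+1}} ⋯ s_{j_ℓ} c)` for the word `w = s_{j₁} ⋯ s_{j_ℓ}`. -/
def kword (k kr ur : Fˣ) (l : List ℕ) (z : E r) : Fˣ :=
  (l.foldr (fun j p => (genF r j p.1, ksj F r k kr ur j p.1 * p.2)) (z, (1 : Fˣ))).2


set_option linter.unusedSectionVars false

/-! ### Basic algebra -/

theorem X_mul (a b : E r) : X F r a * X F r b = X F r (a + b) := by
  simp [X, AddMonoidAlgebra.single_mul_single]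

theorem X_zero : X F r 0 = 1 := rfl

theorem X_ne_one {v : E r} (hv : v ≠ 0) (c : F) : 1 - c • X F r v ≠ 0 := by
  intro h
  have h2 := congrArg (fun p : QA F r => p.coeff 0) h
  rw [← X_zero] at h2
  simp [X, hv] at h2

theorem mkOp_X (Ψ : E r → QA F r) (y : E r) : mkOp F r Ψ (X F r y) = Ψ y := by
  simp [mkOp, X]

/-- The monomial `(c x^v)^m`. -/
def Pm (c : F) (v : E r) (m : ℤ) : QA F r := c ^ m • X F r ((m : ℝ) • v)

theorem Pm_zero (c : F) (v : E r) : Pm F r c v 0 = 1 := by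
  simp [Pm, X_zero]

theorem Pm_one (c : F) (v : E r) : Pm F r c v 1 = c • X F r v := by
  simp [Pm]

theorem Pm_add {c : F} (hc : c ≠ 0) (v : E r) (a b : ℤ) :
    Pm F r c v (a + b) = Pm F r c v a * Pm F r c v b := by
  simp only [Pm, smul_mul_smul_comm, X_mul, zpow_add₀ hc]
  push_cast
  rw [add_smul]

theorem geomS_spec {c : F} (hc : c ≠ 0) (v : E r) (m : ℤ) :
    (1 - Pm F r c v 1) * geomS F r c v m = 1 - Pm F r c v m := by
  have key : ∀ n : ℕ, (1 - Pm F r c v 1) * ∑ t ∈ Finset.range n, Pm F r c v t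
      = 1 - Pm F r c v n := by
    intro n
    induction n with
    | zero => simp [Pm_zero]
    | succ n ih =>
      rw [Finset.sum_range_succ, mul_add, ih]
      push_cast
      rw [Pm_add F r hc]
      ring
  have key2 : ∀ n : ℕ, (1 - Pm F r c v 1) * ∑ t ∈ Finset.range n, Pm F r c v (-(t : ℤ) - 1)
      = Pm F r c v (-(n : ℤ)) - 1 := by
    intro n
    induction n with
    | zero => simp [Pm_zero]
    | succ n ih =>
      rw [Finset.sum_range_succ, mul_add, ih]
      have h1 : Pm F r c v (-(n : ℤ)) = Pm F r c v 1 * Pm F r c v (-(n : ℤ) - 1) := by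
        rw [← Pm_add F r hc]; congr 1; ring
      have h2 : (-((n + 1 : ℕ) : ℤ)) = -(n : ℤ) - 1 := by push_cast; ring
      rw [h2, h1]
      ring
  by_cases h : 0 ≤ m
  · obtain ⟨n, rfl⟩ := Int.eq_ofNat_of_zero_le h
    have := key n
    simp only [geomS, h, if_true]
    simpa [Pm] using this
  · obtain ⟨n, hn⟩ := Int.eq_ofNat_of_zero_le (show 0 ≤ -m by omega)
    obtain rfl : m = -(n : ℤ) := by omega
    have := key2 n
    simp only [geomS, h, if_false]
    have h3 : (∑ t ∈ Finset.range (- -(n:ℤ)).toNat, c ^ (-(t : ℤ) - 1) • X F r ((-(t : ℝ) - 1) • v))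
        = ∑ t ∈ Finset.range n, Pm F r c v (-(t : ℤ) - 1) := by
      simp [Pm]
    rw [h3, mul_neg, this]
    ring

theorem geomS_add {c : F} (hc : c ≠ 0) {v : E r} (hv : v ≠ 0) (a b : ℤ) :
    geomS F r c v (a + b) = geomS F r c v b + Pm F r c v b * geomS F r c v a := by
  have h : (1 - Pm F r c v 1) ≠ 0 := by
    rw [Pm_one]; exact X_ne_one F r hv c
  apply mul_left_cancel₀ h
  rw [mul_add, mul_left_comm, geomS_spec F r hc, geomS_spec F r hc, geomS_spec F r hc,
    Pm_add F r hc]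
  ring

/-! ### Laurent polynomials -/

theorem X_mem (lam : Fin r → ℤ) : X F r (zc r lam) ∈ Lspan F r :=
  Submodule.subset_span ⟨lam, rfl⟩

theorem Lspan_mul {p q : QA F r} (hp : p ∈ Lspan F r) (hq : q ∈ Lspan F r) :
    p * q ∈ Lspan F r := by
  have h := Submodule.mul_mem_mul hp hq
  rw [Lspan, Submodule.span_mul_span] at h
  refine Submodule.span_mono ?_ h
  rintro _ ⟨_, ⟨a, rfl⟩, _, ⟨b, rfl⟩, rfl⟩
  refine ⟨a + b, ?_⟩
  simp only [X_mul]
  congr 1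
  ext m
  simp [zc]

theorem geomS_mem (c : F) (w : Fin r → ℤ) (m : ℤ) : geomS F r c (zc r w) m ∈ Lspan F r := by
  have h : ∀ n : ℤ, X F r ((n : ℝ) • zc r w) ∈ Lspan F r := by
    intro n
    have : (n : ℝ) • zc r w = zc r (n • w) := by
      ext m; simp [zc]
    rw [this]; exact X_mem F r _
  unfold geomS
  split_ifs
  · refine Submodule.sum_mem _ fun t _ => Submodule.smul_mem _ _ ?_
    simpa using h t
  · refine Submodule.neg_mem _ (Submodule.sum_mem _ fun t _ => Submodule.smul_mem _ _ ?_)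
    simpa using h (-(t : ℤ) - 1)

theorem one_mem_L : (1 : QA F r) ∈ Lspan F r := by
  have := X_mem F r 0
  rwa [show zc r 0 = 0 by ext m; simp [zc], X_zero] at this

/-- Reduction of the cross relation to an explicit solution. -/
theorem reduce (O : Set (E r)) (A B S M : QA F r) (T : Module.End F (QA F r)) (R₀ : QA F r)
    (hA : A ≠ 0) (hR : R₀ ∈ Lspan F r) (hE : A * R₀ = B)
    (hT : ∀ y ∈ O, T (M * X F r y) - S * T (X F r y) = R₀ * X F r y) :
    (∃! R : QA F r, R ∈ Lspan F r ∧ A * R = B) ∧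
    (∀ R : QA F r, (R ∈ Lspan F r ∧ A * R = B) →
      ∀ f ∈ FO F r O, T (M * f) - S * T f = R * f) := by
  have hu : ∀ R : QA F r, A * R = B → R = R₀ := fun R h =>
    mul_left_cancel₀ hA (h.trans hE.symm)
  refine ⟨⟨R₀, ⟨hR, hE⟩, fun R h => hu R h.2⟩, ?_⟩
  rintro R ⟨-, h⟩ f hf
  rw [hu R h]
  induction hf using Submodule.span_induction with
  | mem x hx => obtain ⟨y, hy, rfl⟩ := hx; exact hT y hy
  | zero => simp
  | add x y _ _ hx hy =>
    rw [mul_add, map_add, map_add, mul_add, mul_add, ← hx, ← hy]; ring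
  | smul a x _ hx =>
    rw [mul_smul_comm, map_smul, map_smul, mul_smul_comm, mul_smul_comm, ← hx, smul_sub]

/-! ### Floors -/

theorem floorE_add (z : ℝ) (n : ℤ) : floorE (z + 2 * n) = floorE z + 2 * n := by
  unfold floorE
  rw [show (z + 2 * n) / 2 = z / 2 + n by ring, Int.floor_add_intCast]; ring

theorem floorO_add (z : ℝ) (n : ℤ) : floorO (z + 2 * n) = floorO z + 2 * n := by
  unfold floorO
  rw [show (z + 2 * n + 1) / 2 = (z + 1) / 2 + n by ring, Int.floor_add_intCast]; ring

theorem chiZ_add (z : ℝ) (n : ℤ) : chiZ (z + n) = chiZ z := by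
  unfold chiZ
  congr 1
  apply propext
  constructor
  · rintro ⟨a, h⟩; exact ⟨a - n, by push_cast; linarith⟩
  · rintro ⟨a, h⟩; exact ⟨a + n, by push_cast; linarith⟩

theorem chiE_add (z : ℝ) (n : ℤ) : chiE (z + 2 * n) = chiE z := by
  unfold chiE
  congr 1
  apply propext
  constructor
  · rintro ⟨a, h⟩; exact ⟨a - n, by push_cast; linarith⟩
  · rintro ⟨a, h⟩; exact ⟨a + n, by push_cast; linarith⟩

theorem chiO_add (z : ℝ) (n : ℤ) : chiO (z + 2 * n) = chiO z := by
  unfold chiO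
  congr 1
  apply propext
  constructor
  · rintro ⟨a, h⟩; exact ⟨a - n, by push_cast; linarith⟩
  · rintro ⟨a, h⟩; exact ⟨a + n, by push_cast; linarith⟩

theorem floorE_half (z : ℝ) (n : ℤ) :
    -floorE (z + 2 * n) / 2 = -floorE z / 2 + -n := by
  rw [floorE_add]; unfold floorE; omega

theorem floorO_half (z : ℝ) (n : ℤ) :
    (-floorO (z + 2 * n) - 1) / 2 = (-floorO z - 1) / 2 + -n := by
  rw [floorO_add]; unfold floorO; omega

/-! ### Coordinates -/

theorem cd_fin (y : E r) (m : Fin r) : cd r y ((m : ℕ) + 1) = y m := by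
  unfold cd
  rw [Finset.sum_eq_single m]
  · simp
  · intro b _ hb
    rw [if_neg]
    intro h
    exact hb (Fin.ext (by omega))
  · simp

theorem cd_add (y z : E r) (i : ℕ) : cd r (y + z) i = cd r y i + cd r z i := by
  unfold cd
  rw [← Finset.sum_add_distrib]
  refine Finset.sum_congr rfl fun m _ => ?_
  split_ifs <;> simp

/-- integer coordinate -/
def cdz (μ : Fin r → ℤ) (i : ℕ) : ℤ := ∑ m : Fin r, if (m : ℕ) + 1 = i then μ m else 0

theorem cd_zc (μ : Fin r → ℤ) (i : ℕ) : cd r (zc r μ) i = cdz r μ i := by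
  unfold cd cdz zc
  push_cast
  rfl

theorem sW_add (i : ℕ) (y z : E r) : sW r i (y + z) = sW r i y + sW r i z := by
  ext m
  simp only [sW, Pi.add_apply, cd_add]
  split_ifs <;> ring

theorem sEps1_add (y z : E r) : sEps1 r (y + z) = sEps1 r y + sEps1 r z := by
  ext m
  simp only [sEps1, Pi.add_apply]
  split_ifs <;> ring

theorem cdz_fin (μ : Fin r → ℤ) (m : Fin r) : cdz r μ ((m : ℕ) + 1) = μ m := by
  have := cd_fin r (zc r μ) m
  rw [cd_zc] at this
  exact_mod_cast (show ((cdz r μ ((m : ℕ) + 1) : ℤ) : ℝ) = (μ m : ℝ) from this)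

/-! ### The affine Weyl group in coordinates -/

/-- `g` is a signed permutation followed by an integral translation. -/
def SP (g : E r → E r) (π : Equiv.Perm (Fin r)) (s lam : Fin r → ℤ) : Prop :=
  (∀ m, s m = 1 ∨ s m = -1) ∧ ∀ y m, g y m = s m * y (π m) + lam m

theorem sW_swap (a b : Fin r) (hab : (b : ℕ) = a + 1) (y : E r) (m : Fin r) :
    sW r ((a : ℕ) + 1) y m = y (Equiv.swap a b m) := by
  have h1 : (a : ℕ) + 1 ≠ r := by have := b.2; omega
  have h2 : cd r y ((a : ℕ) + 1 + 1) = y b := by rw [← hab, cd_fin]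
  simp only [sW, if_neg h1, h2, cd_fin]
  split_ifs with h3 h4
  · obtain rfl : m = a := Fin.ext (by omega)
    simp
  · obtain rfl : m = b := Fin.ext (by omega)
    simp
  · rw [Equiv.swap_apply_of_ne_of_ne]
    · rintro rfl; exact h3 rfl
    · rintro rfl; exact h4 hab

theorem sW_last (y : E r) (m : Fin r) :
    sW r r y m = if (m : ℕ) + 1 = r then -y m else y m := by
  simp [sW]

theorem gen_cases (hr : 2 ≤ r) (j : ℕ) (hj : j ≤ r) :
    j = 0 ∨ j = r ∨ ∃ a b : Fin r, (b : ℕ) = a + 1 ∧ j = (a : ℕ) + 1 := by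
  by_cases h0 : j = 0
  · exact Or.inl h0
  by_cases h1 : j = r
  · exact Or.inr (Or.inl h1)
  · exact Or.inr (Or.inr ⟨⟨j - 1, by omega⟩, ⟨j, by omega⟩, by simp; omega, by simp; omega⟩)

theorem gen_SP (hr : 2 ≤ r) (j : ℕ) (hj : j ≤ r) : ∃ π s lam, SP r (genF r j) π s lam := by
  rcases gen_cases r hr j hj with rfl | rfl | ⟨a, b, hab, rfl⟩
  · refine ⟨1, fun m => if (m : ℕ) = 0 then -1 else 1, fun m => if (m : ℕ) = 0 then 1 else 0,
      fun m => ?_, fun y m => ?_⟩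
    · by_cases h : (m : ℕ) = 0 <;> simp [h]
    · by_cases h : (m : ℕ) = 0 <;> simp [h, genF]; ring
  · refine ⟨1, fun m => if (m : ℕ) + 1 = j then -1 else 1, fun m => 0,
      fun m => ?_, fun y m => ?_⟩
    · by_cases h : (m : ℕ) + 1 = j <;> simp [h]
    · by_cases h : (m : ℕ) + 1 = j <;> simp [h, genF, sW_last, show j ≠ 0 by omega]
  · refine ⟨Equiv.swap a b, fun _ => 1, fun _ => 0, fun m => Or.inl rfl, fun y m => ?_⟩
    simp [genF, sW_swap r a b hab]

theorem gen_invol (hr : 2 ≤ r) (j : ℕ) (hj : j ≤ r) (y : E r) :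
    genF r j (genF r j y) = y := by
  ext m
  rcases gen_cases r hr j hj with rfl | rfl | ⟨a, b, hab, rfl⟩
  · by_cases h : (m : ℕ) = 0 <;> simp [h, genF]
  · by_cases h : (m : ℕ) + 1 = j <;> simp [h, genF, sW_last, show j ≠ 0 by omega]
  · simp [genF, sW_swap r a b hab]

theorem word_SP (hr : 2 ≤ r) (l : List ℕ) (hl : ∀ a ∈ l, a ≤ r) :
    ∃ π s lam, SP r (wordAct r l) π s lam := by
  induction l with
  | nil => exact ⟨1, fun _ => 1, fun _ => 0, fun _ => Or.inl rfl, fun y m => by simp [wordAct]⟩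
  | cons a l ih =>
    obtain ⟨π, s, lam, h1, h2⟩ := ih fun b hb => hl b (List.mem_cons_of_mem _ hb)
    obtain ⟨π', s', lam', h1', h2'⟩ := gen_SP r hr a (hl a List.mem_cons_self)
    refine ⟨π'.trans π, fun m => s' m * s (π' m), fun m => s' m * lam (π' m) + lam' m,
      fun m => ?_, fun y m => ?_⟩
    · rcases h1' m with h | h <;> rcases h1 (π' m) with h' | h' <;> simp [h, h']
    · change genF r a (wordAct r l y) m = _
      rw [h2', h2]
      simp only [Equiv.trans_apply]
      push_cast
      ring

theorem word_append (l l' : List ℕ) (y : E r) :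
    wordAct r (l ++ l') y = wordAct r l (wordAct r l' y) := by
  simp [wordAct]

theorem word_rev (hr : 2 ≤ r) (l : List ℕ) (hl : ∀ a ∈ l, a ≤ r) (y : E r) :
    wordAct r l (wordAct r l.reverse y) = y := by
  induction l generalizing y with
  | nil => simp [wordAct]
  | cons a l ih =>
    rw [List.reverse_cons, word_append]
    change genF r a (wordAct r l (wordAct r l.reverse (genF r a y))) = y
    rw [ih fun b hb => hl b (List.mem_cons_of_mem _ hb)]
    exact gen_invol r hr a (hl a List.mem_cons_self) y

/-- Two antitone real sequences that are rearrangements of each other agree. -/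
theorem antitone_perm (c c' : Fin r → ℝ) (σ : Equiv.Perm (Fin r)) (hc : Antitone c)
    (hc' : Antitone c') (h : ∀ m, c' m = c (σ m)) : c' = c := by
  have h1 : c' = c ∘ σ := funext h
  have h2 : Monotone ((OrderDual.toDual ∘ c) ∘ σ) := by
    intro a b hab
    have := hc' hab
    rw [h, h] at this
    exact this
  have h3 : Monotone ((OrderDual.toDual ∘ c) ∘ (1 : Equiv.Perm (Fin r))) := fun a b hab => hc hab
  have := Tuple.unique_monotone h2 h3
  ext m
  rw [h]
  exact congrFun this m

theorem fold_unique {x x' : ℝ} {s s' : ℤ} {n : ℤ} (hs : s = 1 ∨ s = -1) (hs' : s' = 1 ∨ s' = -1)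
    (hx : 0 ≤ x ∧ x ≤ 1 / 2) (hx' : 0 ≤ x' ∧ x' ≤ 1 / 2)
    (h : (s' : ℝ) * x' = s * x + n) :
    x' = x ∧ (s = s' ∧ n = 0 ∨ s' = -s ∧ (x = 0 ∧ n = 0 ∨ x = 1 / 2 ∧ n = -s)) := by
  obtain ⟨a, b⟩ := hx
  obtain ⟨a', b'⟩ := hx'
  have hn1 : n ≤ 1 := by
    have : (n : ℝ) < 2 := by
      rcases hs with rfl | rfl <;> rcases hs' with rfl | rfl <;> push_cast at h <;> linarith
    have : n < 2 := by exact_mod_cast this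
    omega
  have hn2 : -1 ≤ n := by
    have : (-2 : ℝ) < n := by
      rcases hs with rfl | rfl <;> rcases hs' with rfl | rfl <;> push_cast at h <;> linarith
    have : -2 < n := by exact_mod_cast this
    omega
  have hn : n = -1 ∨ n = 0 ∨ n = 1 := by omega
  rcases hs with rfl | rfl <;> rcases hs' with rfl | rfl <;> rcases hn with rfl | rfl | rfl <;>
    push_cast at h <;>
    first
    | (exfalso; linarith)
    | exact ⟨by linarith, Or.inl ⟨rfl, rfl⟩⟩
    | exact ⟨by linarith, Or.inr ⟨rfl, Or.inl ⟨by linarith, rfl⟩⟩⟩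
    | exact ⟨by linarith, Or.inr ⟨rfl, Or.inr ⟨by linarith, rfl⟩⟩⟩

theorem alcove_unique {g g' : E r → E r} {π π' : Equiv.Perm (Fin r)} {s s' lam lam' : Fin r → ℤ}
    (hg : SP r g π s lam) (hg' : SP r g' π' s' lam') {c c' : E r} (hc : c ∈ CplusCl r)
    (hc' : c' ∈ CplusCl r) (μ : Fin r → ℤ) (h : g' c' = g c + zc r μ) :
    c' = c ∧ ∀ m, c (π' m) = c (π m) ∧ (s m = s' m ∧ lam' m = lam m + μ m ∨
      s' m = -s m ∧ (c (π m) = 0 ∧ lam' m = lam m + μ m ∨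
        c (π m) = 1 / 2 ∧ lam' m = lam m + μ m + s m)) := by
  have key : ∀ m, _ := fun m =>
    fold_unique (x := c (π m)) (x' := c' (π' m)) (n := lam m + μ m - lam' m) (hg.1 m) (hg'.1 m)
      (hc.2 _) (hc'.2 _) (by
        have := congrFun h m
        rw [hg'.2, Pi.add_apply, hg.2] at this
        simp only [zc] at this
        push_cast
        linarith)
  have hcc : c' = c := by
    refine antitone_perm r c c' (π'.symm.trans π) (fun a b hab => hc.1 a b hab)
      (fun a b hab => hc'.1 a b hab) fun m => ?_
    have := (key (π'.symm m)).1
    simpa using this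
  refine ⟨hcc, fun m => ?_⟩
  obtain ⟨h1, h2⟩ := key m
  rw [hcc] at h1
  refine ⟨h1, ?_⟩
  rcases h2 with h2 | ⟨h2, h3 | h3⟩
  · exact Or.inl ⟨h2.1, by linarith [h2.2]⟩
  · exact Or.inr ⟨h2, Or.inl ⟨h3.1, by linarith [h3.2]⟩⟩
  · exact Or.inr ⟨h2, Or.inr ⟨h3.1, by linarith [h3.2]⟩⟩

/-! ### Existence of an alcove representative -/

/-- A point in the open alcove. -/
def pA : E r := fun m => ((r : ℝ) - (m : ℕ)) / (2 * r + 2)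

/-- Squared distance to the point `pA`. -/
def fA (z : E r) : ℝ := ∑ m : Fin r, (z m - pA r m) ^ 2

theorem pA_lt (a b : Fin r) (hab : (b : ℕ) = a + 1) : pA r b < pA r a := by
  unfold pA
  apply div_lt_div_of_pos_right _ (by positivity)
  rw [hab]; push_cast; linarith

theorem pA_pos (a : Fin r) : 0 < pA r a := by
  unfold pA
  have : ((a : ℕ) : ℝ) < r := by exact_mod_cast a.2
  apply div_pos <;> [linarith; positivity]

theorem pA_half (a : Fin r) : pA r a < 1 / 2 := by
  unfold pA
  rw [div_lt_div_iff₀ (by positivity) (by norm_num)]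
  have : (0 : ℝ) ≤ ((a : ℕ) : ℝ) := by positivity
  linarith

theorem fA_single (z z' : E r) (a : Fin r) (h : ∀ m, m ≠ a → z' m = z m)
    (hlt : (z' a - pA r a) ^ 2 < (z a - pA r a) ^ 2) : fA r z' < fA r z := by
  unfold fA
  refine Finset.sum_lt_sum (fun m _ => ?_) ⟨a, Finset.mem_univ _, hlt⟩
  by_cases hm : m = a
  · rw [hm]; exact hlt.le
  · rw [h m hm]

theorem fA_gen (hr : 2 ≤ r) (z : E r) (hz : ∀ j ≤ r, fA r z ≤ fA r (genF r j z)) :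
    z ∈ CplusCl r := by
  have h0 : z ⟨0, by omega⟩ ≤ 1 / 2 := by
    by_contra hcon
    push Not at hcon
    refine absurd (hz 0 (by omega)) (not_le.2 (fA_single r _ _ ⟨0, by omega⟩ ?_ ?_))
    · intro m hm
      have : (m : ℕ) ≠ 0 := fun h => hm (Fin.ext h)
      simp [genF, this]
    · simp only [genF, if_true]
      have := pA_half r ⟨0, by omega⟩
      nlinarith
  have hl : 0 ≤ z ⟨r - 1, by omega⟩ := by
    by_contra hcon
    push Not at hcon
    refine absurd (hz r le_rfl) (not_le.2 (fA_single r _ _ ⟨r - 1, by omega⟩ ?_ ?_))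
    · intro m hm
      have : (m : ℕ) + 1 ≠ r := fun h => hm (Fin.ext (by simp; omega))
      simp [genF, this, sW_last, show r ≠ 0 by omega]
    · have h1 : r - 1 + 1 = r := by omega
      simp only [genF, sW_last, show r ≠ 0 by omega, if_false, h1, if_true]
      have := pA_pos r ⟨r - 1, by omega⟩
      nlinarith
  have hs : ∀ a b : Fin r, (b : ℕ) = a + 1 → z b ≤ z a := by
    intro a b hab
    by_contra hcon
    push Not at hcon
    have hne : a ≠ b := by rintro rfl; omega
    have h := hz (a + 1) (by have := a.2; omega)
    have hgen : genF r (a + 1) z = fun m => z (Equiv.swap a b m) := by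
      ext m; simp [genF, sW_swap r a b hab]
    rw [hgen] at h
    have h2 : fA r (fun m => z (Equiv.swap a b m)) - fA r z
        = ((z b - pA r a) ^ 2 - (z a - pA r a) ^ 2) + ((z a - pA r b) ^ 2 - (z b - pA r b) ^ 2) := by
      unfold fA
      rw [← Finset.sum_sub_distrib]
      rw [Finset.sum_eq_add a b hne]
      · simp
      · rintro m - ⟨hma, hmb⟩
        simp only [Equiv.swap_apply_of_ne_of_ne hma hmb]; ring
      · simp
      · simp
    have hp := pA_lt r a b hab
    nlinarith
  have hanti : ∀ i j : Fin r, i ≤ j → z j ≤ z i := by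
    have : ∀ n : ℕ, ∀ i j : Fin r, (j : ℕ) = i + n → z j ≤ z i := by
      intro n
      induction n with
      | zero => intro i j h; rw [show j = i from Fin.ext (by omega)]
      | succ n ih =>
        intro i j h
        have hj := j.2
        exact (hs ⟨i + n, by omega⟩ j (by simp; omega)).trans (ih i _ rfl)
    intro i j hij
    exact this (j - i) i j (by have : (i : ℕ) ≤ j := hij; omega)
  refine ⟨hanti, fun m => ⟨hl.trans (hanti _ _ ?_), (hanti _ _ ?_).trans h0⟩⟩
  · have := m.2
    exact Fin.mk_le_mk.2 (by omega) 
  · exact Fin.mk_le_mk.2 (by omega) 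

theorem orbit_finite (hr : 2 ≤ r) (y : E r) (C : ℝ) :
    {z | z ∈ orbit r y ∧ fA r z ≤ C}.Finite := by
  -- coordinates of orbit points lie in a discrete set
  let B : ℝ := C + 2
  have hS : ∀ i : Fin r, ∀ s : ℤ, {x : ℝ | (∃ n : ℤ, x = s * y i + n) ∧ |x| ≤ B}.Finite := by
    intro i s
    refine ((Set.finite_Icc (⌊-B - s * y i⌋) (⌈B - s * y i⌉)).image
      (fun n : ℤ => (s : ℝ) * y i + n)).subset ?_
    rintro x ⟨⟨n, rfl⟩, hx⟩
    rw [abs_le] at hx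
    refine ⟨n, ⟨?_, ?_⟩, rfl⟩
    · have : ((⌊-B - s * y i⌋ : ℤ) : ℝ) ≤ n := (Int.floor_le _).trans (by linarith)
      exact_mod_cast this
    · have : (n : ℝ) ≤ (⌈B - s * y i⌉ : ℤ) := le_trans (by linarith) (Int.le_ceil _)
      exact_mod_cast this
  have hU : (⋃ i : Fin r, ⋃ s ∈ ({1, -1} : Finset ℤ),
      {x : ℝ | (∃ n : ℤ, x = s * y i + n) ∧ |x| ≤ B}).Finite :=
    Set.finite_iUnion fun i => Set.Finite.biUnion (Finset.finite_toSet _) fun s _ => hS i s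
  refine (Set.Finite.pi' (fun _ : Fin r => hU)).subset ?_
  rintro z ⟨⟨l, hl, rfl⟩, hz⟩ m
  obtain ⟨π, s, lam, h1, h2⟩ := word_SP r hr l hl
  refine Set.mem_iUnion.2 ⟨π m, Set.mem_iUnion₂.2 ⟨s m, ?_, ⟨lam m, h2 y m⟩, ?_⟩⟩
  · rcases h1 m with h | h <;> simp [h]
  · have h3 : (wordAct r l y m - pA r m) ^ 2 ≤ C :=
      (Finset.single_le_sum (f := fun m => (wordAct r l y m - pA r m) ^ 2)
        (fun _ _ => sq_nonneg _) (Finset.mem_univ m)).trans hz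
    have h4 := pA_pos r m
    have h5 := pA_half r m
    rw [abs_le]
    constructor <;> nlinarith [sq_nonneg (wordAct r l y m - pA r m - 1),
      sq_nonneg (wordAct r l y m - pA r m + 1)]

theorem exists_alcove (hr : 2 ≤ r) (y : E r) :
    ∃ l : List ℕ, (∀ a ∈ l, a ≤ r) ∧ wordAct r l y ∈ CplusCl r := by
  have hy : y ∈ {z | z ∈ orbit r y ∧ fA r z ≤ fA r y} := ⟨⟨[], by simp, rfl⟩, le_rfl⟩
  obtain ⟨z, ⟨⟨l, hl, rfl⟩, hz2⟩, hmin⟩ :=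
    Set.exists_min_image _ (fA r) (orbit_finite r hr y (fA r y)) ⟨y, hy⟩
  refine ⟨l, hl, fA_gen r hr _ fun j hj => ?_⟩
  by_contra hcon
  push Not at hcon
  refine absurd (hmin (genF r j (wordAct r l y)) ⟨⟨j :: l, ?_, rfl⟩, hcon.le.trans hz2⟩)
    (not_le.2 hcon)
  intro a ha
  rcases List.mem_cons.1 ha with rfl | ha
  · exact hj
  · exact hl a ha

theorem gW_spec (hr : 2 ≤ r) (y : E r) :
    (∀ a ∈ gW r y, a ≤ r) ∧ wordAct r (gW r y).reverse y ∈ CplusCl r := by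
  have h : ∃ l : List ℕ, (∀ a ∈ l, a ≤ r) ∧ wordAct r l.reverse y ∈ CplusCl r ∧
      ∀ l' : List ℕ, (∀ a ∈ l', a ≤ r) → wordAct r l'.reverse y ∈ CplusCl r →
        l.length ≤ l'.length := by
    have hex : ∃ n : ℕ, ∃ l : List ℕ, (∀ a ∈ l, a ≤ r) ∧ wordAct r l.reverse y ∈ CplusCl r ∧
        l.length = n := by
      obtain ⟨l, hl, h⟩ := exists_alcove r hr y
      exact ⟨_, l.reverse, by simpa using hl, by simpa using h, rfl⟩
    obtain ⟨l, hl, h, hn⟩ := Nat.find_spec hex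
    refine ⟨l, hl, h, fun l' hl' h' => ?_⟩
    rw [hn]
    exact Nat.find_min' hex ⟨l', hl', h', rfl⟩
  unfold gW
  rw [dif_pos h]
  exact ⟨h.choose_spec.1, h.choose_spec.2.1⟩

theorem gfun_spec (hr : 2 ≤ r) (y : E r) :
    ∃ c ∈ CplusCl r, gfun r y c = y ∧ ∃ π s lam, SP r (gfun r y) π s lam := by
  obtain ⟨h1, h2⟩ := gW_spec r hr y
  exact ⟨_, h2, word_rev r hr _ h1 y, word_SP r hr _ h1⟩

theorem cpt_spec (hr : 2 ≤ r) (O : Set (E r)) (hO : IsOrbit r O) (y : E r) (hy : y ∈ O) :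
    cpt r O ∈ CplusCl r ∧ ∃ g π s lam, SP r g π s lam ∧ g (cpt r O) = y := by
  obtain ⟨y₀, rfl⟩ := hO
  have h : ∃ c, c ∈ orbit r y₀ ∧ c ∈ CplusCl r := by
    obtain ⟨l, hl, h⟩ := exists_alcove r hr y₀
    exact ⟨_, ⟨l, hl, rfl⟩, h⟩
  have h2 : cpt r (orbit r y₀) ∈ orbit r y₀ ∧ cpt r (orbit r y₀) ∈ CplusCl r := by
    unfold cpt; rw [dif_pos h]; exact h.choose_spec
  refine ⟨h2.2, ?_⟩
  obtain ⟨l, hl, h3⟩ := h2.1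
  obtain ⟨l', hl', h4⟩ := hy
  have hw : ∀ a ∈ l' ++ l.reverse, a ≤ r := by
    intro a ha
    rcases List.mem_append.1 ha with ha | ha
    · exact hl' a ha
    · exact hl a (List.mem_reverse.1 ha)
  obtain ⟨π, s, lam, hsp⟩ := word_SP r hr _ hw
  refine ⟨_, π, s, lam, hsp, ?_⟩
  rw [word_append, ← h3, ← h4]
  congr 1
  have := word_rev r hr l.reverse (by simpa using hl) y₀
  rwa [List.reverse_reverse] at this

/-! ### The torus -/

theorem torusAct_SP (qh : Fˣ) (t : Fin r → Fˣ) {g : E r → E r} {π : Equiv.Perm (Fin r)}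
    {s lam : Fin r → ℤ} (hg : SP r g π s lam) (m : Fin r) :
    torusAct F r qh g t m = (qh * qh) ^ lam m * t (π m) ^ s m := by
  unfold torusAct
  have h0 : g 0 m = lam m := by rw [hg.2]; simp
  have h1 : ∀ j, ⌊(g (eV r j) - g 0) m⌋ = if j = π m then s m else 0 := by
    intro j
    rw [Pi.sub_apply, h0, hg.2]
    simp only [eV]
    by_cases h : j = π m
    · simp [h]
    · simp [h, Ne.symm h]
  rw [h0, Int.floor_intCast]
  congr 1
  rw [Finset.prod_eq_single (π m)]
  · rw [h1]; simp
  · intro b _ hb; rw [h1]; simp [hb]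
  · simp

theorem tcU_fin (t : Fin r → Fˣ) (m : Fin r) : tcU F r t ((m : ℕ) + 1) = t m := by
  unfold tcU
  rw [Finset.prod_eq_single m]
  · simp
  · intro b _ hb
    rw [if_neg]
    intro h
    exact hb (Fin.ext (by omega))
  · simp

theorem t_const (hr : 2 ≤ r) (qh : Fˣ) (O : Set (E r)) (t : Fin r → Fˣ) (ht : t ∈ TOset F r qh O)
    (hc : cpt r O ∈ CplusCl r) (i j : Fin r) (h : cpt r O i = cpt r O j) : t i = t j := by
  have main : ∀ n : ℕ, ∀ i j : Fin r, (j : ℕ) = i + n → cpt r O i = cpt r O j → t i = t j := by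
    intro n
    induction n with
    | zero => intro i j h _; rw [show j = i from Fin.ext (by omega)]
    | succ n ih =>
      intro i j h he
      have hj := j.2
      let b : Fin r := ⟨i + n, by omega⟩
      have hb1 : cpt r O j ≤ cpt r O b := hc.1 _ _ (Fin.mk_le_mk.2 (by omega))
      have hb2 : cpt r O b ≤ cpt r O i := hc.1 _ _ (Fin.mk_le_mk.2 (by omega))
      rw [ih i b rfl (by linarith)]
      have hb : (j : ℕ) = b + 1 := by simp [b]; omega
      have h1 := ht ((b : ℕ) + 1) (by omega)
      have h2 : (b : ℕ) + 1 ≠ r := by omega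
      simp only [alphaF, tpowCo, h2, if_false, Nat.add_eq_zero_iff, one_ne_zero, and_false,
        cd_fin, tcU_fin] at h1
      rw [← hb, cd_fin, tcU_fin] at h1
      exact mul_inv_eq_one.1 (h1 (by linarith))
  rcases le_total i j with hij | hij
  · exact main (j - i) i j (by have : (i : ℕ) ≤ j := hij; omega) h
  · exact (main (i - j) j i (by have : (j : ℕ) ≤ i := hij; omega) h.symm).symm

theorem t_zero (hr : 2 ≤ r) (qh : Fˣ) (O : Set (E r)) (t : Fin r → Fˣ) (ht : t ∈ TOset F r qh O)
    (hc : cpt r O ∈ CplusCl r) (i : Fin r) (h : cpt r O i = 0) : t i = 1 := by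
  let b : Fin r := ⟨r - 1, by omega⟩
  have hb : cpt r O b ≤ cpt r O i := hc.1 _ _ (Fin.mk_le_mk.2 (by omega))
  have hb0 : cpt r O b = 0 := le_antisymm (by linarith) (hc.2 b).1
  rw [t_const F r hr qh O t ht hc i b (by rw [h, hb0])]
  have h1 := ht r le_rfl
  have h2 : cd r (cpt r O) r = cpt r O b := by
    rw [← cd_fin r (cpt r O) b]; congr 1; simp [b]; omega
  have h3 : tcU F r t r = t b := by
    rw [← tcU_fin F r t b]; congr 1; simp [b]; omega
  simp only [alphaF, tpowCo, show r ≠ 0 by omega, if_false, if_true, h2, h3] at h1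
  exact h1 (by rw [hb0]; simp)

theorem t_half (hr : 2 ≤ r) (qh : Fˣ) (O : Set (E r)) (t : Fin r → Fˣ) (ht : t ∈ TOset F r qh O)
    (hc : cpt r O ∈ CplusCl r) (i : Fin r) (h : cpt r O i = 1 / 2) : t i = qh := by
  let b : Fin r := ⟨0, by omega⟩
  have hb : cpt r O i ≤ cpt r O b := hc.1 _ _ (Fin.mk_le_mk.2 (by omega))
  have hb0 : cpt r O b = 1 / 2 := le_antisymm (hc.2 b).2 (by linarith)
  rw [t_const F r hr qh O t ht hc i b (by rw [h, hb0])]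
  have h1 := ht 0 (by omega)
  have h2 : cd r (cpt r O) 1 = cpt r O b := cd_fin r _ b
  have h3 : tcU F r t 1 = t b := tcU_fin F r t b
  simp only [alphaF, tpowCo, if_true, h2, h3] at h1
  exact (mul_inv_eq_one.1 (h1 (by rw [hb0]; norm_num))).symm

theorem torus_shift (hr : 2 ≤ r) (qh : Fˣ) (O : Set (E r)) (hO : IsOrbit r O) (t : Fin r → Fˣ)
    (ht : t ∈ TOset F r qh O) (y : E r) (hy : y ∈ O) (μ : Fin r → ℤ) (m : Fin r) :
    torusAct F r qh (gfun r (zc r μ + y)) t m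
      = (qh * qh) ^ μ m * torusAct F r qh (gfun r y) t m := by
  obtain ⟨hcp, g, π₀, s₀, lam₀, hg₀, hgy⟩ := cpt_spec r hr O hO y hy
  obtain ⟨c, hc, hcy, π, s, lam, hg⟩ := gfun_spec r hr y
  obtain ⟨c', hc', hcy', π', s', lam', hg'⟩ := gfun_spec r hr (zc r μ + y)
  have e1 : c = cpt r O := (alcove_unique r hg₀ hg hcp hc 0 (by
    rw [hcy, hgy]; ext m; simp [zc])).1
  obtain ⟨-, h2⟩ := alcove_unique r hg hg' hc hc' μ (by rw [hcy, hcy', add_comm])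
  rw [torusAct_SP F r qh t hg, torusAct_SP F r qh t hg']
  subst e1
  obtain ⟨h3, h4⟩ := h2 m
  rw [t_const F r hr qh O t ht hcp _ _ h3]
  rcases h4 with ⟨h4, h5⟩ | ⟨h4, ⟨h6, h5⟩ | ⟨h6, h5⟩⟩
  · rw [h4, h5, zpow_add]; 
    rw [mul_comm ((qh * qh) ^ lam m), mul_assoc]
  · rw [t_zero F r hr qh O t ht hcp _ h6, h5, one_zpow, one_zpow, mul_one, mul_one, zpow_add,
      mul_comm]
  · rw [t_half F r hr qh O t ht hcp _ h6, h5, h4]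
    rw [show qh * qh = qh ^ (2 : ℤ) from (zpow_two qh).symm]
    simp only [← zpow_mul, ← zpow_add]
    congr 1; ring

/-! ### The cross relations -/

theorem Pm_double {c : F} (v : E r) (n : ℤ) :
    Pm F r c v (2 * n) = Pm F r (c * c) ((2 : ℝ) • v) n := by
  unfold Pm
  rw [zpow_mul, smul_smul]
  congr 2
  · rw [zpow_two]
  · push_cast; rw [mul_comm]

theorem sq_Pm (c : F) (v : E r) :
    (c • X F r v) ^ 2 = Pm F r (c * c) ((2 : ℝ) • v) 1 := by
  rw [sq, smul_mul_smul_comm, X_mul, Pm_one, two_smul]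

theorem long_case (O : Set (E r)) (c : F) (hc : c ≠ 0) (v : E r) (w : Fin r → ℤ)
    (hvw : v = zc r w) (hv : v ≠ 0) (A B : F) (n : ℤ) (μ : Fin r → ℤ) (S : QA F r)
    (hS : S = X F r (zc r μ) * Pm F r (c * c) ((2 : ℝ) • v) (-n)) (T : Module.End F (QA F r))
    (a : E r → ℝ) (H : E r → QA F r)
    (hT : ∀ y, T (X F r y) = H y
      + A • (geomS F r (c * c) ((2 : ℝ) • v) (-floorE (a y) / 2) * X F r y)
      + B • ((c • X F r v) * geomS F r (c * c) ((2 : ℝ) • v) ((-floorO (a y) - 1) / 2) * X F r y))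
    (ha : ∀ y, a (zc r μ + y) = a y + 2 * n)
    (hH : ∀ y ∈ O, H (zc r μ + y) = S * H y) :
    (∃! R : QA F r, R ∈ Lspan F r ∧ (1 - (c • X F r v) ^ 2) * R
        = (A • (1 : QA F r) + B • (c • X F r v)) * (X F r (zc r μ) - S)) ∧
    (∀ R : QA F r, (R ∈ Lspan F r ∧ (1 - (c • X F r v) ^ 2) * R
        = (A • (1 : QA F r) + B • (c • X F r v)) * (X F r (zc r μ) - S)) →
      ∀ f ∈ FO F r O, T (X F r (zc r μ) * f) - S * T f = R * f) := by
  have hcc : c * c ≠ 0 := mul_ne_zero hc hc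
  have h2v : (2 : ℝ) • v ≠ 0 := smul_ne_zero two_ne_zero hv
  refine reduce F r O _ _ _ _ T
    ((A • (1 : QA F r) + B • (c • X F r v)) *
      (X F r (zc r μ) * geomS F r (c * c) ((2 : ℝ) • v) (-n))) ?_ ?_ ?_ ?_
  · rw [sq_Pm, Pm_one]; exact X_ne_one F r h2v _
  · refine Lspan_mul F r ?_ (Lspan_mul F r (X_mem F r μ) ?_)
    · refine Submodule.add_mem _ (Submodule.smul_mem _ _ (one_mem_L F r))
        (Submodule.smul_mem _ _ (Submodule.smul_mem _ _ ?_))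
      rw [hvw]; exact X_mem F r w
    · have : (2 : ℝ) • v = zc r ((2 : ℤ) • w) := by
        rw [hvw]; ext m; simp [zc]
      rw [this]; exact geomS_mem F r _ _ _
  · have := geomS_spec F r hcc ((2 : ℝ) • v) (-n)
    rw [sq_Pm, hS]
    linear_combination (A • (1 : QA F r) + B • (c • X F r v)) * X F r (zc r μ) * this
  · intro y hy
    rw [X_mul, hT, hT, ha, hH y hy, floorE_half, floorO_half, geomS_add F r hcc h2v,
      geomS_add F r hcc h2v, ← X_mul, hS]
    simp only [Algebra.smul_def]
    ring

theorem short_case (O : Set (E r)) (v : E r) (w : Fin r → ℤ)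
    (hvw : v = zc r w) (hv : v ≠ 0) (A : F) (n : ℤ) (μ : Fin r → ℤ) (S : QA F r)
    (hS : S = X F r (zc r μ) * Pm F r 1 v (-n)) (T : Module.End F (QA F r))
    (a : E r → ℝ) (H : E r → QA F r)
    (hT : ∀ y, T (X F r y) = H y + A • (geomS F r 1 v (-⌊a y⌋) * X F r y))
    (ha : ∀ y, a (zc r μ + y) = a y + n)
    (hH : ∀ y ∈ O, H (zc r μ + y) = S * H y) :
    (∃! R : QA F r, R ∈ Lspan F r ∧ (1 - (X F r v) ^ 2) * R
        = (A • (1 : QA F r) + A • (X F r v)) * (X F r (zc r μ) - S)) ∧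
    (∀ R : QA F r, (R ∈ Lspan F r ∧ (1 - (X F r v) ^ 2) * R
        = (A • (1 : QA F r) + A • (X F r v)) * (X F r (zc r μ) - S)) →
      ∀ f ∈ FO F r O, T (X F r (zc r μ) * f) - S * T f = R * f) := by
  have h2v : (2 : ℝ) • v ≠ 0 := smul_ne_zero two_ne_zero hv
  refine reduce F r O _ _ _ _ T
    (A • (X F r (zc r μ) * geomS F r 1 v (-n))) ?_ ?_ ?_ ?_
  · have := X_ne_one F r h2v 1
    rwa [one_smul, two_smul, ← X_mul, ← sq] at this
  · refine Submodule.smul_mem _ _ (Lspan_mul F r (X_mem F r μ) ?_)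
    rw [hvw]; exact geomS_mem F r _ _ _
  · have := geomS_spec F r one_ne_zero v (-n)
    rw [Pm_one, one_smul] at this
    rw [hS]
    simp only [Algebra.smul_def]
    linear_combination algebraMap F (QA F r) A * (1 + X F r v) * X F r (zc r μ) * this
  · intro y hy
    rw [X_mul, hT, hT, ha, hH y hy, Int.floor_add_intCast, neg_add, geomS_add F r one_ne_zero hv,
      ← X_mul, hS]
    simp only [Algebra.smul_def]
    ring

theorem epsV_zc (i : ℕ) : epsV r i = zc r (fun m => if (m : ℕ) + 1 = i then 1 else 0) := by
  ext m; simp [epsV, zc]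

theorem epsV_fin (m : Fin r) : epsV r ((m : ℕ) + 1) m = 1 := by simp [epsV]

theorem cross_zero (hr : 2 ≤ r)
    (qh k0 u0 k kr ur : Fˣ) (O : Set (E r)) (hO : IsOrbit r O)
    (t : Fin r → Fˣ) (ht : t ∈ TOset F r qh O) (μ : Fin r → ℤ) (S : QA F r)
    (hS : S = (((qh * qh) ^ cdz r μ 1 : Fˣ) : F) • X F r (sEps1 r (zc r μ))) :
    (∃! R : QA F r, R ∈ Lspan F r ∧ (1 - ((qh : F) • X F r ((-1 : ℝ) • epsV r 1)) ^ 2) * R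
        = (((k0 : F) - (k0 : F)⁻¹) • (1 : QA F r)
          + ((u0 : F) - (u0 : F)⁻¹) • ((qh : F) • X F r ((-1 : ℝ) • epsV r 1)))
            * (X F r (zc r μ) - S)) ∧
    (∀ R : QA F r, (R ∈ Lspan F r ∧ (1 - ((qh : F) • X F r ((-1 : ℝ) • epsV r 1)) ^ 2) * R
        = (((k0 : F) - (k0 : F)⁻¹) • (1 : QA F r)
          + ((u0 : F) - (u0 : F)⁻¹) • ((qh : F) • X F r ((-1 : ℝ) • epsV r 1)))
            * (X F r (zc r μ) - S)) →
      ∀ f ∈ FO F r O, Tfull F r qh (k0 : F) (u0 : F) (k : F) (kr : F) (ur : F) t 0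
          (X F r (zc r μ) * f)
        - S * Tfull F r qh (k0 : F) (u0 : F) (k : F) (kr : F) (ur : F) t 0 f = R * f) := by
  let b : Fin r := ⟨0, by omega⟩
  have h22 : (2 : ℝ) • ((-1 : ℝ) • epsV r 1) = (-2 : ℝ) • epsV r 1 := by
    rw [smul_smul]; norm_num
  refine long_case F r O (qh : F) (Units.ne_zero _) _
    (fun m => if (m : ℕ) + 1 = 1 then -1 else 0) ?_ ?_ _ _ (-cdz r μ 1) μ S ?_ _
    (fun y => -2 * cd r y 1)
    (fun y => ((k0 : F) ^ chiE (2 * cd r y 1) * (u0 : F) ^ chiO (2 * cd r y 1) *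
      ((tcU F r (torusAct F r qh (gfun r y) t) 1 : Fˣ) : F)) • X F r (sEps1 r y)) ?_ ?_ ?_
  · ext m; simp [epsV, zc]
  · intro h
    have := congrFun h b
    simp [epsV, b] at this
  · rw [hS, h22, neg_neg, Pm, mul_smul_comm, X_mul]
    congr 2
    · push_cast; rfl
    · ext m
      by_cases hm : (m : ℕ) = 0
      · obtain rfl : m = b := Fin.ext hm
        have : cdz r μ 1 = μ b := cdz_fin r μ b
        simp [sEps1, zc, epsV, this, b]; ring
      · simp [sEps1, zc, epsV, hm]
  · intro y
    rw [h22]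
    simp only [Tfull, if_true, T0op, mkOp_X, T0el, nabla0eEl, nabla0oEl]
  · intro y
    rw [cd_add, cd_zc]; push_cast; ring
  · intro y hy
    have e : (2 : ℝ) * cd r (zc r μ + y) 1 = 2 * cd r y 1 + 2 * (cdz r μ 1 : ℤ) := by
      rw [cd_add, cd_zc]; ring
    have e2 := torus_shift F r hr qh O hO t ht y hy μ b
    have e3 : cdz r μ 1 = μ b := cdz_fin r μ b
    have e4 : ∀ t : Fin r → Fˣ, tcU F r t 1 = t b := fun t => tcU_fin F r t b
    simp only [e, chiE_add, chiO_add, e4, e2, sEps1_add, hS, e3]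
    rw [smul_mul_smul_comm, X_mul]
    congr 1
    push_cast
    ring

theorem cross_last (hr : 2 ≤ r)
    (qh k0 u0 k kr ur : Fˣ) (O : Set (E r))
    (t : Fin r → Fˣ) (μ : Fin r → ℤ) (S : QA F r) (hS : S = X F r (sW r r (zc r μ))) :
    (∃! R : QA F r, R ∈ Lspan F r ∧ (1 - (X F r (epsV r r)) ^ 2) * R
        = (((kr : F) - (kr : F)⁻¹) • (1 : QA F r)
          + ((ur : F) - (ur : F)⁻¹) • (X F r (epsV r r))) * (X F r (zc r μ) - S)) ∧
    (∀ R : QA F r, (R ∈ Lspan F r ∧ (1 - (X F r (epsV r r)) ^ 2) * R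
        = (((kr : F) - (kr : F)⁻¹) • (1 : QA F r)
          + ((ur : F) - (ur : F)⁻¹) • (X F r (epsV r r))) * (X F r (zc r μ) - S)) →
      ∀ f ∈ FO F r O, Tfull F r qh (k0 : F) (u0 : F) (k : F) (kr : F) (ur : F) t r
          (X F r (zc r μ) * f)
        - S * Tfull F r qh (k0 : F) (u0 : F) (k : F) (kr : F) (ur : F) t r f = R * f) := by
  let b : Fin r := ⟨r - 1, by omega⟩
  have hb : (b : ℕ) + 1 = r := by simp [b]; omega
  have key := long_case F r O (1 : F) one_ne_zero (epsV r r) _ (epsV_zc r r) (by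
      intro h
      have := congrFun h b
      simp [epsV, hb] at this) ((kr : F) - (kr : F)⁻¹) ((ur : F) - (ur : F)⁻¹) (cdz r μ r) μ S
      (by
        rw [hS, Pm, mul_one, one_zpow, one_smul, X_mul]
        congr 1
        ext m
        rw [sW_last]
        by_cases hm : (m : ℕ) + 1 = r
        · have : cdz r μ r = μ m := by rw [← cdz_fin r μ m, hm]
          simp [zc, epsV, this, hm]; ring
        · simp [zc, epsV, hm])
      (Tfull F r qh (k0 : F) (u0 : F) (k : F) (kr : F) (ur : F) t r)
      (fun y => 2 * cd r y r)
      (fun y => ((kr : F) ^ chiE (2 * cd r y r) * (ur : F) ^ chiO (2 * cd r y r)) •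
        X F r (sW r r y))
      (by
        intro y
        simp only [Tfull, show r ≠ 0 by omega, if_false, Top, mkOp_X, Tel, if_true, nablaReEl,
          nablaRoEl, one_smul, mul_one])
      (by
        intro y
        simp only [cd_add, cd_zc]; ring)
      (by
        intro y hy
        have e : (2 : ℝ) * cd r (zc r μ + y) r = 2 * cd r y r + 2 * (cdz r μ r : ℤ) := by
          rw [cd_add, cd_zc]; ring
        simp only [e, chiE_add, chiO_add, sW_add, hS]
        rw [mul_smul_comm, X_mul])
  simpa only [one_smul] using key

theorem cross_mid (a b : Fin r) (hab : (b : ℕ) = a + 1)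
    (qh k0 u0 k kr ur : Fˣ) (O : Set (E r))
    (t : Fin r → Fˣ) (μ : Fin r → ℤ) (S : QA F r)
    (hS : S = X F r (sW r ((a : ℕ) + 1) (zc r μ))) :
    (∃! R : QA F r, R ∈ Lspan F r ∧
      (1 - (X F r (epsV r ((a : ℕ) + 1) - epsV r ((a : ℕ) + 1 + 1))) ^ 2) * R
        = (((k : F) - (k : F)⁻¹) • (1 : QA F r)
          + ((k : F) - (k : F)⁻¹) • (X F r (epsV r ((a : ℕ) + 1) - epsV r ((a : ℕ) + 1 + 1))))
            * (X F r (zc r μ) - S)) ∧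
    (∀ R : QA F r, (R ∈ Lspan F r ∧
      (1 - (X F r (epsV r ((a : ℕ) + 1) - epsV r ((a : ℕ) + 1 + 1))) ^ 2) * R
        = (((k : F) - (k : F)⁻¹) • (1 : QA F r)
          + ((k : F) - (k : F)⁻¹) • (X F r (epsV r ((a : ℕ) + 1) - epsV r ((a : ℕ) + 1 + 1))))
            * (X F r (zc r μ) - S)) →
      ∀ f ∈ FO F r O, Tfull F r qh (k0 : F) (u0 : F) (k : F) (kr : F) (ur : F) t ((a : ℕ) + 1)
          (X F r (zc r μ) * f)
        - S * Tfull F r qh (k0 : F) (u0 : F) (k : F) (kr : F) (ur : F) t ((a : ℕ) + 1) f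
          = R * f) := by
  have hne : (a : ℕ) + 1 ≠ r := by have := b.2; omega
  have hv1 : ∀ y : E r, cd r y ((a : ℕ) + 1 + 1) = y b := fun y => by rw [← hab, cd_fin]
  refine short_case F r O _ (fun m : Fin r => (if (m : ℕ) + 1 = a + 1 then 1 else 0)
    - if (m : ℕ) + 1 = a + 1 + 1 then 1 else 0) ?_ ?_ _ (μ a - μ b) μ S ?_ _
    (fun y => cd r y ((a : ℕ) + 1) - cd r y ((a : ℕ) + 1 + 1))
    (fun y => (k : F) ^ chiZ (cd r y ((a : ℕ) + 1) - cd r y ((a : ℕ) + 1 + 1)) •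
      X F r (sW r ((a : ℕ) + 1) y)) ?_ ?_ ?_
  · rw [epsV_zc, epsV_zc]; ext m; simp [zc]
  · intro h
    have := congrFun h a
    simp [epsV] at this
  · rw [hS, Pm, one_zpow, one_smul, X_mul]
    congr 1
    ext m
    rw [sW_swap r a b hab]
    by_cases h1 : m = a
    · subst h1; simp [zc, epsV]
    · by_cases h2 : m = b
      · subst h2; simp [zc, epsV, hab]
      · have h1' : (m : ℕ) ≠ a := fun h => h1 (Fin.ext h)
        have h2' : (m : ℕ) ≠ a + 1 := fun h => h2 (Fin.ext (by omega))
        rw [Equiv.swap_apply_of_ne_of_ne h1 h2]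
        simp [zc, epsV, h1', h2']
  · intro y
    simp only [Tfull, show (a : ℕ) + 1 ≠ 0 by omega, if_false, Top, mkOp_X, Tel, hne, nablaIel]
  · intro y
    simp only [hv1, cd_fin, Pi.add_apply, zc]; push_cast; ring
  · intro y hy
    have e : cd r (zc r μ + y) ((a : ℕ) + 1) - cd r (zc r μ + y) ((a : ℕ) + 1 + 1)
        = cd r y ((a : ℕ) + 1) - cd r y ((a : ℕ) + 1 + 1) + ((μ a - μ b : ℤ) : ℝ) := by
      simp only [hv1, cd_fin, Pi.add_apply, zc]; push_cast; ring
    simp only [e, chiZ_add, sW_add, hS]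
    rw [mul_smul_comm, X_mul]

/-- The cross relations of the quasi-polynomial representation of
Sahi's five-parameter double affine Hecke algebra of type `C^∨C_r`: for each
`j ∈ {0,…,r}` and `μ ∈ ℤ^r` there is a unique Laurent polynomial `R_{j,μ}` with
`(1 - (x^{α_j^∨})²)·R_{j,μ} = (k_j - k_j⁻¹ + (u_j - u_j⁻¹)x^{α_j^∨})·(x^μ - s_j(x^μ))`,
and `T_j^𝒪 ∘ m_{x^μ} - m_{s_j(x^μ)} ∘ T_j^𝒪 = m_{R_{j,μ}}` on `F[𝒪]`. -/
theorem statement5 (F : Type*) [Field F] [CharZero F] (r : ℕ) (hr : 2 ≤ r)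
    (qh k0 u0 k kr ur : Fˣ) (O : Set (E r)) (hO : IsOrbit r O)
    (t : Fin r → Fˣ) (ht : t ∈ TOset F r qh O) (j : ℕ) (hj : j ≤ r) (μ : Fin r → ℤ) :
    letI xaj : QA F r :=
      if j = 0 then (qh : F) • X F r ((-1 : ℝ) • epsV r 1)
      else if j = r then X F r (epsV r r)
      else X F r (epsV r j - epsV r (j + 1))
    letI sjX : QA F r :=
      if j = 0 then
        (((qh * qh) ^ (∑ m : Fin r, if (m : ℕ) + 1 = 1 then μ m else 0) : Fˣ) : F) •
          X F r (sEps1 r (zc r μ))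
      else X F r (sW r j (zc r μ))
    letI kj : F := if j = 0 then (k0 : F) else if j = r then (kr : F) else (k : F)
    letI uj : F := if j = 0 then (u0 : F) else if j = r then (ur : F) else (k : F)
    (∃! R : QA F r, R ∈ Lspan F r ∧
        (1 - xaj ^ 2) * R
          = ((kj - kj⁻¹) • (1 : QA F r) + (uj - uj⁻¹) • xaj) * (X F r (zc r μ) - sjX)) ∧
    (∀ R : QA F r,
      (R ∈ Lspan F r ∧
        (1 - xaj ^ 2) * R
          = ((kj - kj⁻¹) • (1 : QA F r) + (uj - uj⁻¹) • xaj) * (X F r (zc r μ) - sjX)) →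
      ∀ f ∈ FO F r O,
        Tfull F r qh (k0 : F) (u0 : F) (k : F) (kr : F) (ur : F) t j (X F r (zc r μ) * f)
            - sjX * Tfull F r qh (k0 : F) (u0 : F) (k : F) (kr : F) (ur : F) t j f
          = R * f) := by
  rcases gen_cases r hr j hj with rfl | rfl | ⟨a, b, hab, rfl⟩
  · exact cross_zero F r hr qh k0 u0 k kr ur O hO t ht μ _ rfl
  · have h0 : j ≠ 0 := by omega
    simp only [if_neg h0, if_true]
    exact cross_last F j hr qh k0 u0 k kr ur O t μ _ rfl
  · have h0 : (a : ℕ) + 1 ≠ 0 := by omega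
    have h1 : (a : ℕ) + 1 ≠ r := by have := b.2; omega
    simp only [if_neg h0, if_neg h1]
    exact cross_mid F r a b hab qh k0 u0 k kr ur O t μ _ rfl

end QP

end
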